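/- Let ν be a probability measure on a measurable space Ω₀. Let f : ℝ^d → ℝ be differentiable with L-Lipschitz continuous gradient (L > 0) and μ-strongly convex (μ > 0), i.e., ⟨x - y, ∇f(x) - ∇f(y)⟩ ≥ μ‖x - y‖² for all x, y. Let T : ℝ^d → ℝ^d be nonexpansive (1-Lipschitz), γ > 0, and x* ∈ ℝ^d with T(x* - γ∇f(x*)) = x*. Let h : ℝ^d × Ω₀ → ℝ^d be (jointly) measurable with, for every x: ∫ h(x, ω) dν(ω) = ∇f(x) and ∫ ‖h(x, ω)‖² dν(ω) ≤ M‖∇f(x)‖² + σ² (M > 0, σ ∈ ℝ). Set ρ = γμ(1 - 2γLM), assume ρ ∈ (0,1), and set σ₁² = 2(1 + 2M)‖∇f(x*)‖² + 2σ². Fix x₀ ∈ ℝ^d and define recursively X₀ = x₀ and, for ω = (ω₀, …, ω_{t}) ∈ Ω₀^{t+1}, X_{t+1}(ω) = T(X_t(ω₀, …, ω_{t-1}) - γ·h(X_t(ω₀, …, ω_{t-1}), ω_t)). Then for every t ≥ 0, ∫ ‖X_t - x*‖² d(ν^{⊗t}) ≤ (1 - ρ)^t ‖x₀ - x*‖²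 + γ²σ₁²/ρ; i.e., the method converges linearly to a noise-dominated region of squared radius proportional to γ²σ₁². -/

import Mathlib

open MeasureTheory
open scoped RealInnerProductSpace

theorem aux_line {E : Type*} [NormedAddCommGroup E] [InnerProductSpace ℝ E] [CompleteSpace E]
    (f : E → ℝ) (hf : Differentiable ℝ f) (x v : E) (t : ℝ) :
    HasDerivAt (fun s : ℝ => f (x + s • v)) ⟪gradient f (x + t • v), v⟫ t := by
  have h1 := (hf (x + t • v)).hasGradientAt.hasFDerivAt
  have h2 : HasDerivAt (fun s : ℝ => x + s • v) v t := by
    simpa using ((hasDerivAt_id t).smul_const v).const_add x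
  have := h1.comp_hasDerivAt t h2
  simpa [Function.comp_def] using this

theorem aux_descent {E : Type*} [NormedAddCommGroup E] [InnerProductSpace ℝ E] [CompleteSpace E]
    (f : E → ℝ) (hf : Differentiable ℝ f) (L : ℝ)
    (hLip : ∀ y z, ‖gradient f y - gradient f z‖ ≤ L * ‖y - z‖) (x v : E) :
    f (x + v) ≤ f x + ⟪gradient f x, v⟫ + L / 2 * ‖v‖ ^ 2 := by
  have hd : ∀ t : ℝ, HasDerivAt
      (fun s : ℝ => f (x + s • v) - s * ⟪gradient f x, v⟫ - s ^ 2 * (L / 2 * ‖v‖ ^ 2))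
      (⟪gradient f (x + t • v), v⟫ - ⟪gradient f x, v⟫ - 2 * t * (L / 2 * ‖v‖ ^ 2)) t := by
    intro t
    have h1 := (hasDerivAt_id t).mul_const ⟪gradient f x, v⟫
    have h2 := (hasDerivAt_pow 2 t).mul_const (L / 2 * ‖v‖ ^ 2)
    exact (((aux_line f hf x v t).sub h1).sub h2).congr_deriv (by simp)
  have hanti := antitoneOn_of_deriv_nonpos (convex_Icc (0 : ℝ) 1)
    (fun t _ => (hd t).continuousAt.continuousWithinAt)
    (fun t _ => (hd t).differentiableAt.differentiableWithinAt)
    (by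
      intro t ht
      rw [interior_Icc] at ht
      rw [(hd t).deriv, ← inner_sub_left]
      have h1 := real_inner_le_norm (gradient f (x + t • v) - gradient f x) v
      have h2 := hLip (x + t • v) x
      rw [add_sub_cancel_left, norm_smul, Real.norm_of_nonneg ht.1.le] at h2
      nlinarith [mul_le_mul_of_nonneg_right h2 (norm_nonneg v)])
  have := hanti (Set.left_mem_Icc.2 zero_le_one) (Set.right_mem_Icc.2 zero_le_one) zero_le_one
  simp only [zero_smul, one_smul, add_zero, zero_mul, one_mul, sub_zero, one_pow,
    zero_pow two_ne_zero] at this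
  linarith

theorem aux_lower {E : Type*} [NormedAddCommGroup E] [InnerProductSpace ℝ E] [CompleteSpace E]
    (f : E → ℝ) (hf : Differentiable ℝ f)
    (hm : ∀ y z, 0 ≤ ⟪y - z, gradient f y - gradient f z⟫) (x v : E) :
    f x + ⟪gradient f x, v⟫ ≤ f (x + v) := by
  have hd : ∀ t : ℝ, HasDerivAt
      (fun s : ℝ => f (x + s • v) - s * ⟪gradient f x, v⟫)
      (⟪gradient f (x + t • v), v⟫ - ⟪gradient f x, v⟫) t := by
    intro t
    have h1 := (hasDerivAt_id t).mul_const ⟪gradient f x, v⟫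
    exact ((aux_line f hf x v t).sub h1).congr_deriv (by simp)
  have hanti := monotoneOn_of_deriv_nonneg (convex_Icc (0 : ℝ) 1)
    (fun t _ => (hd t).continuousAt.continuousWithinAt)
    (fun t _ => (hd t).differentiableAt.differentiableWithinAt)
    (by
      intro t ht
      rw [interior_Icc] at ht
      rw [(hd t).deriv, ← inner_sub_left]
      have h2 := hm (x + t • v) x
      rw [add_sub_cancel_left, inner_smul_left, real_inner_comm] at h2
      exact nonneg_of_mul_nonneg_right h2 ht.1)
  have := hanti (Set.left_mem_Icc.2 zero_le_one) (Set.right_mem_Icc.2 zero_le_one) zero_le_one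
  simp only [zero_smul, one_smul, add_zero, zero_mul, one_mul, sub_zero, one_pow,
    zero_pow two_ne_zero] at this
  linarith

theorem aux_half {E : Type*} [NormedAddCommGroup E] [InnerProductSpace ℝ E] [CompleteSpace E]
    (f : E → ℝ) (hf : Differentiable ℝ f) (L : ℝ) (hL : 0 < L)
    (hLip : ∀ y z, ‖gradient f y - gradient f z‖ ≤ L * ‖y - z‖)
    (hm : ∀ y z, 0 ≤ ⟪y - z, gradient f y - gradient f z⟫) (x y : E) :
    ‖gradient f x - gradient f y‖ ^ 2 ≤
      2 * L * (f x - f y - ⟪gradient f y, x - y⟫) := by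
  set u := gradient f x - gradient f y with hu
  have h1 := aux_descent f hf L hLip x (-(L⁻¹) • u)
  have h2 := aux_lower f hf hm y (x + -(L⁻¹) • u - y)
  rw [add_sub_cancel] at h2
  have e1 : ⟪gradient f y, x + -(L⁻¹) • u - y⟫ =
      ⟪gradient f y, x - y⟫ - L⁻¹ * ⟪gradient f y, u⟫ := by
    rw [show x + -(L⁻¹) • u - y = (x - y) + -(L⁻¹) • u by abel, inner_add_right,
      inner_smul_right]
    ring
  have e2 : ⟪gradient f x, u⟫ - ⟪gradient f y, u⟫ = ‖u‖ ^ 2 := by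
    rw [← inner_sub_left, ← hu, real_inner_self_eq_norm_sq]
  rw [inner_smul_right, norm_smul, norm_neg, Real.norm_of_nonneg (inv_nonneg.2 hL.le)] at h1
  rw [e1] at h2
  have h3 : L⁻¹ * ‖u‖ ^ 2 ≤ f x - f y - ⟪gradient f y, x - y⟫ + L / 2 * (L⁻¹ * ‖u‖) ^ 2 := by
    rw [← e2] at *
    nlinarith
  have h4 : L / 2 * (L⁻¹ * ‖u‖) ^ 2 = L⁻¹ * ‖u‖ ^ 2 / 2 := by field_simp
  rw [h4] at h3
  have h5 : L⁻¹ * ‖u‖ ^ 2 ≤ 2 * (f x - f y - ⟪gradient f y, x - y⟫) := by linarith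
  have h6 := mul_le_mul_of_nonneg_left h5 hL.le
  rw [← mul_assoc, mul_inv_cancel₀ hL.ne', one_mul] at h6
  linarith

theorem aux_coco {E : Type*} [NormedAddCommGroup E] [InnerProductSpace ℝ E] [CompleteSpace E]
    (f : E → ℝ) (hf : Differentiable ℝ f) (L : ℝ) (hL : 0 < L)
    (hLip : ∀ y z, ‖gradient f y - gradient f z‖ ≤ L * ‖y - z‖)
    (hm : ∀ y z, 0 ≤ ⟪y - z, gradient f y - gradient f z⟫) (x y : E) :
    ‖gradient f x - gradient f y‖ ^ 2 ≤ L * ⟪x - y, gradient f x - gradient f y⟫ := by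
  have h1 := aux_half f hf L hL hLip hm x y
  have h2 := aux_half f hf L hL hLip hm y x
  rw [norm_sub_rev, ← neg_sub x y, inner_neg_right] at h2
  rw [inner_sub_right, real_inner_comm _ (x - y), real_inner_comm _ (x - y)]
  linarith

/-- One step of the method, for a deterministic starting point. -/
theorem aux_step {E Ω₀ : Type*} [NormedAddCommGroup E] [InnerProductSpace ℝ E] [CompleteSpace E]
    [MeasurableSpace Ω₀] (ν : Measure Ω₀) [IsProbabilityMeasure ν]
    (T : E → E) (hT : LipschitzWith 1 T) (γ : ℝ) (hγ : 0 < γ)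
    (x xs g gs : E) (hfix : T (xs - γ • gs) = xs) (h : Ω₀ → E)
    (hint : Integrable h ν) (hL2 : Integrable (fun a => ‖h a‖ ^ 2) ν)
    (hunb : ∫ a, h a ∂ν = g) (M σ L μ : ℝ) (hM : 0 < M)
    (hwgc : ∫ a, ‖h a‖ ^ 2 ∂ν ≤ M * ‖g‖ ^ 2 + σ ^ 2)
    (hco : ‖g - gs‖ ^ 2 ≤ L * ⟪x - xs, g - gs⟫)
    (hsc : μ * ‖x - xs‖ ^ 2 ≤ ⟪x - xs, g - gs⟫)
    (hpos : 0 ≤ 1 - 2 * γ * L * M) (hμ : 0 < μ) :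
    ∫⁻ a, ENNReal.ofReal (‖T (x - γ • h a) - xs‖ ^ 2) ∂ν ≤
      ENNReal.ofReal ((1 - γ * μ * (1 - 2 * γ * L * M)) * ‖x - xs‖ ^ 2 +
        γ ^ 2 * (2 * (1 + 2 * M) * ‖gs‖ ^ 2 + 2 * σ ^ 2)) := by
  have par : ∀ p q : E, ‖p + q‖ ^ 2 ≤ 2 * ‖p‖ ^ 2 + 2 * ‖q‖ ^ 2 := by
    intro p q
    nlinarith [norm_add_le p q, norm_nonneg (p + q), sq_nonneg (‖p‖ - ‖q‖)]
  have hpt : ∀ a, ‖T (x - γ • h a) - xs‖ ^ 2 ≤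
      ‖x - xs‖ ^ 2 - 2 * γ * (⟪x - xs, h a⟫ - ⟪x - xs, gs⟫) +
        γ ^ 2 * (2 * ‖h a‖ ^ 2 + 2 * ‖gs‖ ^ 2) := by
    intro a
    have h1 : ‖T (x - γ • h a) - xs‖ ≤ ‖(x - xs) - γ • (h a - gs)‖ := by
      have := hT.norm_sub_le (x - γ • h a) (xs - γ • gs)
      rw [hfix, NNReal.coe_one, one_mul] at this
      refine this.trans_eq ?_
      congr 1
      rw [smul_sub]; abel
    have h2 : ‖(x - xs) - γ • (h a - gs)‖ ^ 2 = ‖x - xs‖ ^ 2 -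
        2 * γ * (⟪x - xs, h a⟫ - ⟪x - xs, gs⟫) + γ ^ 2 * ‖h a - gs‖ ^ 2 := by
      rw [norm_sub_sq_real, inner_smul_right, norm_smul, inner_sub_right, mul_pow,
        Real.norm_eq_abs, sq_abs]
      ring
    have h3 := par (h a) (-gs)
    rw [← sub_eq_add_neg, norm_neg] at h3
    have h4 := mul_le_mul_of_nonneg_left h3 (sq_nonneg γ)
    have h5 := pow_le_pow_left₀ (norm_nonneg _) h1 2
    linarith
  have i1 : Integrable (fun a => ⟪x - xs, h a⟫ - ⟪x - xs, gs⟫) ν :=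
    (hint.const_inner _).sub (integrable_const _)
  have i2 : Integrable (fun a => ‖x - xs‖ ^ 2 - 2 * γ * (⟪x - xs, h a⟫ - ⟪x - xs, gs⟫)) ν :=
    (integrable_const _).sub (i1.const_mul _)
  have i3 : Integrable (fun a => γ ^ 2 * (2 * ‖h a‖ ^ 2 + 2 * ‖gs‖ ^ 2)) ν :=
    ((hL2.const_mul 2).add (integrable_const _)).const_mul _
  have hI : ∫ a, (‖x - xs‖ ^ 2 - 2 * γ * (⟪x - xs, h a⟫ - ⟪x - xs, gs⟫) +
        γ ^ 2 * (2 * ‖h a‖ ^ 2 + 2 * ‖gs‖ ^ 2)) ∂ν =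
      ‖x - xs‖ ^ 2 - 2 * γ * ⟪x - xs, g - gs⟫ +
        γ ^ 2 * (2 * ∫ a, ‖h a‖ ^ 2 ∂ν + 2 * ‖gs‖ ^ 2) := by
    rw [integral_add i2 i3, integral_sub (integrable_const _) (i1.const_mul _),
      integral_const_mul, integral_const_mul,
      integral_sub (hint.const_inner _) (integrable_const _),
      integral_add (hL2.const_mul 2) (integrable_const _), integral_const_mul,
      integral_inner hint, hunb, inner_sub_right]
    simp
  calc _ ≤ ∫⁻ a, ENNReal.ofReal (‖x - xs‖ ^ 2 - 2 * γ * (⟪x - xs, h a⟫ - ⟪x - xs, gs⟫) +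
        γ ^ 2 * (2 * ‖h a‖ ^ 2 + 2 * ‖gs‖ ^ 2)) ∂ν :=
        lintegral_mono fun a => ENNReal.ofReal_le_ofReal (hpt a)
    _ = ENNReal.ofReal (∫ a, (‖x - xs‖ ^ 2 - 2 * γ * (⟪x - xs, h a⟫ - ⟪x - xs, gs⟫) +
        γ ^ 2 * (2 * ‖h a‖ ^ 2 + 2 * ‖gs‖ ^ 2)) ∂ν) :=
        (ofReal_integral_eq_lintegral_ofReal (i2.add i3)
          (Filter.Eventually.of_forall fun a => (sq_nonneg _).trans (hpt a))).symm
    _ ≤ _ := by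
      apply ENNReal.ofReal_le_ofReal
      rw [hI]
      have h3 := par (g - gs) gs
      rw [sub_add_cancel] at h3
      have h4 : 2 * ∫ a, ‖h a‖ ^ 2 ∂ν + 2 * ‖gs‖ ^ 2 ≤
          4 * M * (L * ⟪x - xs, g - gs⟫) + (2 * (1 + 2 * M) * ‖gs‖ ^ 2 + 2 * σ ^ 2) := by
        nlinarith [mul_le_mul_of_nonneg_left h3 hM.le, mul_le_mul_of_nonneg_left hco hM.le]
      have h5 := mul_le_mul_of_nonneg_left h4 (sq_nonneg γ)
      have h6 := mul_le_mul_of_nonneg_left hsc (mul_nonneg hγ.le hpos)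
      have h7 : 0 ≤ γ * (1 - 2 * γ * L * M) * (μ * ‖x - xs‖ ^ 2) := by positivity
      nlinarith

/-- Iterated (multi-step) form of Proposition 1: the proximal (nonexpansive-map)
stochastic gradient method with constant step-size, driven by i.i.d. samples,
converges linearly to a noise-dominated region of squared radius `γ²σ₁²/ρ`. -/
theorem stmt_13 {d : ℕ} {Ω₀ : Type*} [MeasurableSpace Ω₀] (ν : Measure Ω₀)
    [IsProbabilityMeasure ν]
    (f : EuclideanSpace ℝ (Fin d) → ℝ) (hfdiff : Differentiable ℝ f)
    (L : ℝ) (hL : 0 < L)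
    (hLip : ∀ y z, ‖gradient f y - gradient f z‖ ≤ L * ‖y - z‖)
    (μ : ℝ) (hμ : 0 < μ)
    (hsc : ∀ y z, ⟪y - z, gradient f y - gradient f z⟫ ≥ μ * ‖y - z‖ ^ 2)
    (T : EuclideanSpace ℝ (Fin d) → EuclideanSpace ℝ (Fin d))
    (hT : LipschitzWith 1 T)
    (γ : ℝ) (hγ : 0 < γ)
    (xstar : EuclideanSpace ℝ (Fin d))
    (hfix : T (xstar - γ • gradient f xstar) = xstar)
    (h : EuclideanSpace ℝ (Fin d) → Ω₀ → EuclideanSpace ℝ (Fin d))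
    (hmeas : Measurable (Function.uncurry h))
    (hint : ∀ x, Integrable (h x) ν)
    (hL2 : ∀ x, Integrable (fun a => ‖h x a‖ ^ 2) ν)
    (hunbiased : ∀ x, ∫ a, h x a ∂ν = gradient f x)
    (M σ : ℝ) (hM : 0 < M)
    (hwgc : ∀ x, ∫ a, ‖h x a‖ ^ 2 ∂ν ≤ M * ‖gradient f x‖ ^ 2 + σ ^ 2)
    (ρ : ℝ) (hρ : ρ = γ * μ * (1 - 2 * γ * L * M)) (hρmem : ρ ∈ Set.Ioo (0 : ℝ) 1)
    (σ1sq : ℝ) (hσ1 : σ1sq = 2 * (1 + 2 * M) * ‖gradient f xstar‖ ^ 2 + 2 * σ ^ 2)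
    (x₀ : EuclideanSpace ℝ (Fin d))
    (X : (t : ℕ) → (Fin t → Ω₀) → EuclideanSpace ℝ (Fin d))
    (hX0 : ∀ w, X 0 w = x₀)
    (hXsucc : ∀ t (w : Fin (t + 1) → Ω₀),
      X (t + 1) w =
        T (X t (fun i => w i.castSucc) -
            γ • h (X t (fun i => w i.castSucc)) (w (Fin.last t)))) :
    ∀ t, ∫ w, ‖X t w - xstar‖ ^ 2 ∂(Measure.pi fun _ : Fin t => ν) ≤
      (1 - ρ) ^ t * ‖x₀ - xstar‖ ^ 2 + γ ^ 2 * σ1sq / ρ := by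
  have hρ0 := hρmem.1
  have hρ1 := hρmem.2
  have hpos : 0 ≤ 1 - 2 * γ * L * M := by
    rw [hρ] at hρ0
    exact (pos_of_mul_pos_right hρ0 (mul_pos hγ hμ).le).le
  have hm : ∀ y z, 0 ≤ ⟪y - z, gradient f y - gradient f z⟫ := fun y z =>
    le_trans (by positivity) (hsc y z)
  have hσ0 : 0 ≤ γ ^ 2 * σ1sq := by rw [hσ1]; positivity
  have hXm : ∀ t, Measurable (X t) := by
    intro t
    induction t with
    | zero =>
      rw [show X 0 = fun _ => x₀ from funext hX0]
      exact measurable_const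
    | succ t ih =>
      rw [show X (t + 1) = _ from funext (hXsucc t)]
      have h1 : Measurable (fun w : Fin (t + 1) → Ω₀ => X t (fun i => w i.castSucc)) :=
        ih.comp (measurable_pi_lambda _ fun i => measurable_pi_apply _)
      have h2 : Measurable (fun w : Fin (t + 1) → Ω₀ =>
          h (X t (fun i => w i.castSucc)) (w (Fin.last t))) :=
        hmeas.comp (h1.prodMk (measurable_pi_apply _))
      exact hT.continuous.measurable.comp (h1.sub (h2.const_smul γ))
  have key : ∀ t, ∫⁻ w, ENNReal.ofReal (‖X t w - xstar‖ ^ 2) ∂(Measure.pi fun _ : Fin t => ν) ≤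
      ENNReal.ofReal ((1 - ρ) ^ t * ‖x₀ - xstar‖ ^ 2 + γ ^ 2 * σ1sq / ρ) := by
    intro t
    induction t with
    | zero =>
      simp only [hX0, lintegral_const, measure_univ, mul_one, pow_zero, one_mul]
      apply ENNReal.ofReal_le_ofReal
      have : 0 ≤ γ ^ 2 * σ1sq / ρ := by positivity
      linarith
    | succ t ih =>
      have hmp := (measurePreserving_piFinSuccAbove (fun _ : Fin (t + 1) => ν) (Fin.last t)).symm
      have hmX : ∀ s, Measurable fun w => ENNReal.ofReal (‖X s w - xstar‖ ^ 2) := fun s =>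
        (((hXm s).sub_const xstar).norm.pow_const 2).ennreal_ofReal
      rw [← hmp.lintegral_comp (hmX (t + 1))]
      refine (lintegral_prod_symm' _ ((hmX (t + 1)).comp hmp.measurable)).trans_le ?_
      calc _ ≤ ∫⁻ w, (ENNReal.ofReal (1 - ρ) * ENNReal.ofReal (‖X t w - xstar‖ ^ 2) +
              ENNReal.ofReal (γ ^ 2 * σ1sq)) ∂(Measure.pi fun _ : Fin t => ν) := by
            refine lintegral_mono fun w => ?_
            have := aux_step ν T hT γ hγ (X t w) xstar (gradient f (X t w)) (gradient f xstar)
              hfix (h (X t w)) (hint _) (hL2 _) (hunbiased _) M σ L μ hM (hwgc _)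
              (aux_coco f hfdiff L hL hLip hm _ _) (hsc _ _) hpos hμ
            rw [← hρ, ← hσ1, ENNReal.ofReal_add (mul_nonneg (by linarith) (sq_nonneg _)) hσ0,
              ENNReal.ofReal_mul (by linarith)] at this
            refine le_trans (le_of_eq ?_) this
            refine lintegral_congr fun a => ?_
            rw [Function.comp_apply, hXsucc]
            simp [MeasurableEquiv.piFinSuccAbove, Fin.insertNthEquiv]
        _ = ENNReal.ofReal (1 - ρ) * ∫⁻ w, ENNReal.ofReal (‖X t w - xstar‖ ^ 2)
              ∂(Measure.pi fun _ : Fin t => ν) + ENNReal.ofReal (γ ^ 2 * σ1sq) := by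
            rw [lintegral_add_right _ measurable_const, lintegral_const_mul _ (hmX t)]
            simp
        _ ≤ ENNReal.ofReal (1 - ρ) * ENNReal.ofReal ((1 - ρ) ^ t * ‖x₀ - xstar‖ ^ 2 +
              γ ^ 2 * σ1sq / ρ) + ENNReal.ofReal (γ ^ 2 * σ1sq) := by gcongr
        _ = _ := by
            have h1 : 0 ≤ 1 - ρ := by linarith
            rw [← ENNReal.ofReal_mul h1, ← ENNReal.ofReal_add (by positivity) hσ0]
            congr 1
            field_simp
            ring
  intro t
  have h1 : 0 ≤ 1 - ρ := by linarith
  rw [integral_eq_lintegral_of_nonneg_ae (Filter.Eventually.of_forall fun w => sq_nonneg _)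
    (((hXm t).sub_const xstar).norm.pow_const 2).aestronglyMeasurable]
  exact ENNReal.toReal_le_of_le_ofReal (by positivity) (key t)
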